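/- (Theorem 1) For ℓ = 1,…,L let W^{(ℓ)} ∈ ℝ^{C×C}, let P^{(ℓ)}_1,…,P^{(ℓ)}_C be N×N permutation matrices (which may be chosen depending on the input to layer ℓ), and let F_ℓ: ℝ^{N×C} → ℝ^{N×C} apply a map f_ℓ: ℝ^C → ℝ^C to each row, where F_ℓ satisfies ‖F_ℓ(Y) − 1_N f_ℓ(a)^⊤‖_p ≤ λ_ℓ ‖Y − 1_N a^⊤‖_p for p ∈ {1, ∞}, all Y ∈ ℝ^{N×C}, and all a ∈ ℝ^C. Set λ = max_ℓ λ_ℓ and β = max_ℓ ‖W^{(ℓ)}‖₁. Then for every X ∈ ℝ^{N×C}, the output Z = (F_L ∘ CSP_{W^{(L)}}) ∘ ⋯ ∘ (F_1 ∘ CSP_{W^{(1)}})(X) satisfies r_{1,∞}(Z) ≤ C^{L/2} (λβ)^L · r_{1,∞}(X). -/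

import Mathlib

open scoped BigOperators

/-- Maximum absolute column sum norm `‖X‖₁` of an `N × C` real matrix. -/
noncomputable def colNorm {N C : ℕ} (X : Matrix (Fin N) (Fin C) ℝ) : ℝ :=
  ⨆ c : Fin C, ∑ n : Fin N, |X n c|

/-- Maximum absolute row sum norm `‖X‖_∞` of an `N × C` real matrix. -/
noncomputable def rowNorm {N C : ℕ} (X : Matrix (Fin N) (Fin C) ℝ) : ℝ :=
  ⨆ n : Fin N, ∑ c : Fin C, |X n c|

/-- Rank-one residual `r₁(X) = inf_x ‖X − 1_N x^⊤‖₁`. -/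
noncomputable def r1 {N C : ℕ} (X : Matrix (Fin N) (Fin C) ℝ) : ℝ :=
  ⨅ x : Fin C → ℝ, colNorm (X - Matrix.of fun _ c => x c)

/-- Rank-one residual `r_∞(X) = inf_x ‖X − 1_N x^⊤‖_∞`. -/
noncomputable def rInf {N C : ℕ} (X : Matrix (Fin N) (Fin C) ℝ) : ℝ :=
  ⨅ x : Fin C → ℝ, rowNorm (X - Matrix.of fun _ c => x c)

/-- `r_{1,∞}(X) = √(r₁(X) · r_∞(X))`. -/
noncomputable def r1Inf {N C : ℕ} (X : Matrix (Fin N) (Fin C) ℝ) : ℝ :=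
  Real.sqrt (r1 X * rInf X)

/-- `P` is a permutation matrix. -/
def IsPermMatrix {N : ℕ} (P : Matrix (Fin N) (Fin N) ℝ) : Prop :=
  ∃ σ : Equiv.Perm (Fin N), ∀ i j, P i j = if i = σ j then 1 else 0

/-- The CSP operator: the `c`-th column of `CSP P W X` is `P_c X w_c`,
where `w_c` is the `c`-th column of `W`. -/
noncomputable def CSP {N C : ℕ} (P : Fin C → Matrix (Fin N) (Fin N) ℝ)
    (W : Matrix (Fin C) (Fin C) ℝ) (X : Matrix (Fin N) (Fin C) ℝ) :
    Matrix (Fin N) (Fin C) ℝ :=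
  Matrix.of fun n c => (P c).mulVec (X.mulVec fun r => W r c) n

section Residuals

variable {N C : ℕ}

theorem colNorm_nonneg (X : Matrix (Fin N) (Fin C) ℝ) : 0 ≤ colNorm X :=
  Real.iSup_nonneg fun _ => Finset.sum_nonneg fun _ _ => abs_nonneg _

theorem rowNorm_nonneg (X : Matrix (Fin N) (Fin C) ℝ) : 0 ≤ rowNorm X :=
  Real.iSup_nonneg fun _ => Finset.sum_nonneg fun _ _ => abs_nonneg _

theorem sum_abs_col_le_colNorm (X : Matrix (Fin N) (Fin C) ℝ) (c : Fin C) :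
    ∑ n, |X n c| ≤ colNorm X :=
  le_ciSup (f := fun c => ∑ n, |X n c|) (Set.finite_range _).bddAbove c

theorem sum_abs_row_le_rowNorm (X : Matrix (Fin N) (Fin C) ℝ) (n : Fin N) :
    ∑ c, |X n c| ≤ rowNorm X :=
  le_ciSup (f := fun n => ∑ c, |X n c|) (Set.finite_range _).bddAbove n

theorem abs_entry_le_colNorm (X : Matrix (Fin N) (Fin C) ℝ) (n : Fin N) (c : Fin C) :
    |X n c| ≤ colNorm X :=
  (Finset.single_le_sum (f := fun n => |X n c|) (fun _ _ => abs_nonneg _)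
    (Finset.mem_univ n)).trans (sum_abs_col_le_colNorm X c)

theorem r1_le (X : Matrix (Fin N) (Fin C) ℝ) (x : Fin C → ℝ) :
    r1 X ≤ colNorm (X - Matrix.of fun _ c => x c) :=
  ciInf_le ⟨0, by rintro _ ⟨y, rfl⟩; exact colNorm_nonneg _⟩ x

theorem rInf_le (X : Matrix (Fin N) (Fin C) ℝ) (x : Fin C → ℝ) :
    rInf X ≤ rowNorm (X - Matrix.of fun _ c => x c) :=
  ciInf_le ⟨0, by rintro _ ⟨y, rfl⟩; exact rowNorm_nonneg _⟩ x

theorem r1_nonneg (X : Matrix (Fin N) (Fin C) ℝ) : 0 ≤ r1 X :=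
  Real.iInf_nonneg fun _ => colNorm_nonneg _

theorem rInf_nonneg (X : Matrix (Fin N) (Fin C) ℝ) : 0 ≤ rInf X :=
  Real.iInf_nonneg fun _ => rowNorm_nonneg _

theorem r1Inf_eq_zero_of_isEmpty [IsEmpty (Fin N × Fin C)] (X : Matrix (Fin N) (Fin C) ℝ) :
    r1Inf X = 0 := by
  have h : r1 X = 0 := by
    rcases isEmpty_prod.1 ‹IsEmpty (Fin N × Fin C)› with h | h <;>
      simp [r1, colNorm]
  simp [r1Inf, h]

/-- Subtracting the constant rows `Wᵀ x` from the output of CSP amounts to permuting the columns of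
`(X - 1 xᵀ) W`. -/
theorem exists_perm_CSP_sub_apply {P : Fin C → Matrix (Fin N) (Fin N) ℝ}
    (hP : ∀ c, IsPermMatrix (P c)) (W : Matrix (Fin C) (Fin C) ℝ)
    (X : Matrix (Fin N) (Fin C) ℝ) (x : Fin C → ℝ) :
    ∃ σ : Fin C → Equiv.Perm (Fin N), ∀ n c,
      (CSP P W X - Matrix.of fun _ c => ∑ r, x r * W r c : Matrix (Fin N) (Fin C) ℝ) n c =
        ∑ r, (X - Matrix.of fun _ c => x c : Matrix (Fin N) (Fin C) ℝ) (σ c n) r * W r c := by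
  choose σ hσ using hP
  refine ⟨fun c => (σ c)⁻¹, fun n c => ?_⟩
  have hmul : ∀ v : Fin N → ℝ, (P c).mulVec v n = v ((σ c)⁻¹ n) := fun v => by
    simp only [Matrix.mulVec, dotProduct, hσ, ite_mul, one_mul, zero_mul]
    rw [Finset.sum_eq_single ((σ c)⁻¹ n)]
    · simp
    · intro j _ hj
      exact if_neg fun h => hj (by simp [h])
    · simp
  simp only [CSP, Matrix.sub_apply, Matrix.of_apply, hmul, sub_mul, Finset.sum_sub_distrib]
  rfl

theorem colNorm_CSP_sub_le {P : Fin C → Matrix (Fin N) (Fin N) ℝ}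
    (hP : ∀ c, IsPermMatrix (P c)) (W : Matrix (Fin C) (Fin C) ℝ)
    (X : Matrix (Fin N) (Fin C) ℝ) (x : Fin C → ℝ) :
    colNorm (CSP P W X - Matrix.of fun _ c => ∑ r, x r * W r c) ≤
      colNorm W * colNorm (X - Matrix.of fun _ c => x c) := by
  obtain ⟨σ, hσ⟩ := exists_perm_CSP_sub_apply hP W X x
  set R := X - Matrix.of fun _ c => x c
  refine Real.iSup_le (fun c => ?_) (mul_nonneg (colNorm_nonneg _) (colNorm_nonneg _))
  simp only [hσ]
  calc ∑ n, |∑ r, R (σ c n) r * W r c|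
      = ∑ n, |∑ r, R n r * W r c| :=
        Equiv.sum_comp (σ c) fun n => |∑ r, R n r * W r c|
    _ ≤ ∑ n, ∑ r, |R n r| * |W r c| :=
        Finset.sum_le_sum fun n _ =>
          (Finset.abs_sum_le_sum_abs _ _).trans_eq (by simp only [abs_mul])
    _ = ∑ r, |W r c| * ∑ n, |R n r| := by
        rw [Finset.sum_comm]
        simp only [Finset.mul_sum, mul_comm]
    _ ≤ ∑ r, |W r c| * colNorm R :=
        Finset.sum_le_sum fun r _ =>
          mul_le_mul_of_nonneg_left (sum_abs_col_le_colNorm R r) (abs_nonneg _)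
    _ = (∑ r, |W r c|) * colNorm R := by rw [Finset.sum_mul]
    _ ≤ colNorm W * colNorm R :=
        mul_le_mul_of_nonneg_right (sum_abs_col_le_colNorm W c) (colNorm_nonneg _)

theorem rowNorm_CSP_sub_le {P : Fin C → Matrix (Fin N) (Fin N) ℝ}
    (hP : ∀ c, IsPermMatrix (P c)) (W : Matrix (Fin C) (Fin C) ℝ)
    (X : Matrix (Fin N) (Fin C) ℝ) (x : Fin C → ℝ) :
    rowNorm (CSP P W X - Matrix.of fun _ c => ∑ r, x r * W r c) ≤
      C * colNorm W * rowNorm (X - Matrix.of fun _ c => x c) := by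
  obtain ⟨σ, hσ⟩ := exists_perm_CSP_sub_apply hP W X x
  set R := X - Matrix.of fun _ c => x c
  refine Real.iSup_le (fun n => ?_)
    (mul_nonneg (mul_nonneg (Nat.cast_nonneg _) (colNorm_nonneg _)) (rowNorm_nonneg _))
  simp only [hσ]
  calc ∑ c, |∑ r, R (σ c n) r * W r c|
      ≤ ∑ c, ∑ r, |R (σ c n) r| * |W r c| :=
        Finset.sum_le_sum fun c _ =>
          (Finset.abs_sum_le_sum_abs _ _).trans_eq (by simp only [abs_mul])
    _ ≤ ∑ c, (∑ r, |R (σ c n) r|) * colNorm W :=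
        Finset.sum_le_sum fun c _ => by
          rw [Finset.sum_mul]
          exact Finset.sum_le_sum fun r _ =>
            mul_le_mul_of_nonneg_left (abs_entry_le_colNorm W r c) (abs_nonneg _)
    _ ≤ ∑ _c : Fin C, rowNorm R * colNorm W :=
        Finset.sum_le_sum fun c _ =>
          mul_le_mul_of_nonneg_right (sum_abs_row_le_rowNorm R _) (colNorm_nonneg _)
    _ = C * colNorm W * rowNorm R := by
        simp only [Finset.sum_const, Finset.card_univ, Fintype.card_fin, nsmul_eq_mul]
        ring

theorem nonneg_of_colNorm_le_mul (hN : 0 < N) (hC : 0 < C)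
    {f : (Fin C → ℝ) → (Fin C → ℝ)} {l : ℝ}
    (hf : ∀ (Y : Matrix (Fin N) (Fin C) ℝ) (a : Fin C → ℝ),
      colNorm ((Matrix.of fun n c => f (Y n) c) - Matrix.of fun _ c => f a c) ≤
        l * colNorm (Y - Matrix.of fun _ c => a c)) : 0 ≤ l := by
  let Y : Matrix (Fin N) (Fin C) ℝ := Matrix.of fun _ _ => 1
  have hpos : 0 < colNorm (Y - Matrix.of fun _ _ => 0) :=
    lt_of_lt_of_le (by simp [Y]) (abs_entry_le_colNorm _ ⟨0, hN⟩ ⟨0, hC⟩)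
  exact nonneg_of_mul_nonneg_left ((colNorm_nonneg _).trans (hf Y fun _ => 0)) hpos

theorem r1_layer_le {P : Fin C → Matrix (Fin N) (Fin N) ℝ}
    (hP : ∀ c, IsPermMatrix (P c)) (W : Matrix (Fin C) (Fin C) ℝ)
    {f : (Fin C → ℝ) → (Fin C → ℝ)} {l : ℝ} (hl : 0 ≤ l)
    (hf : ∀ (Y : Matrix (Fin N) (Fin C) ℝ) (a : Fin C → ℝ),
      colNorm ((Matrix.of fun n c => f (Y n) c) - Matrix.of fun _ c => f a c) ≤
        l * colNorm (Y - Matrix.of fun _ c => a c))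
    (X : Matrix (Fin N) (Fin C) ℝ) :
    r1 (Matrix.of fun n c => f (CSP P W X n) c) ≤ l * colNorm W * r1 X := by
  conv_rhs => rw [r1]
  rw [Real.mul_iInf_of_nonneg (mul_nonneg hl (colNorm_nonneg _))]
  refine le_ciInf fun x => (r1_le _ _).trans ((hf _ fun c => ∑ r, x r * W r c).trans ?_)
  rw [mul_assoc]
  exact mul_le_mul_of_nonneg_left (colNorm_CSP_sub_le hP W X x) hl

theorem rInf_layer_le {P : Fin C → Matrix (Fin N) (Fin N) ℝ}
    (hP : ∀ c, IsPermMatrix (P c)) (W : Matrix (Fin C) (Fin C) ℝ)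
    {f : (Fin C → ℝ) → (Fin C → ℝ)} {l : ℝ} (hl : 0 ≤ l)
    (hf : ∀ (Y : Matrix (Fin N) (Fin C) ℝ) (a : Fin C → ℝ),
      rowNorm ((Matrix.of fun n c => f (Y n) c) - Matrix.of fun _ c => f a c) ≤
        l * rowNorm (Y - Matrix.of fun _ c => a c))
    (X : Matrix (Fin N) (Fin C) ℝ) :
    rInf (Matrix.of fun n c => f (CSP P W X n) c) ≤ l * (C * colNorm W) * rInf X := by
  conv_rhs => rw [rInf]
  rw [Real.mul_iInf_of_nonneg
    (mul_nonneg hl (mul_nonneg (Nat.cast_nonneg _) (colNorm_nonneg _)))]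
  refine le_ciInf fun x => (rInf_le _ _).trans ((hf _ fun c => ∑ r, x r * W r c).trans ?_)
  rw [mul_assoc]
  exact mul_le_mul_of_nonneg_left (rowNorm_CSP_sub_le hP W X x) hl

theorem r1Inf_layer_le {P : Fin C → Matrix (Fin N) (Fin N) ℝ}
    (hP : ∀ c, IsPermMatrix (P c)) (W : Matrix (Fin C) (Fin C) ℝ)
    {f : (Fin C → ℝ) → (Fin C → ℝ)} {l : ℝ} (hl : 0 ≤ l)
    (hf1 : ∀ (Y : Matrix (Fin N) (Fin C) ℝ) (a : Fin C → ℝ),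
      colNorm ((Matrix.of fun n c => f (Y n) c) - Matrix.of fun _ c => f a c) ≤
        l * colNorm (Y - Matrix.of fun _ c => a c))
    (hfInf : ∀ (Y : Matrix (Fin N) (Fin C) ℝ) (a : Fin C → ℝ),
      rowNorm ((Matrix.of fun n c => f (Y n) c) - Matrix.of fun _ c => f a c) ≤
        l * rowNorm (Y - Matrix.of fun _ c => a c))
    (X : Matrix (Fin N) (Fin C) ℝ) :
    r1Inf (Matrix.of fun n c => f (CSP P W X n) c) ≤
      Real.sqrt C * (l * colNorm W) * r1Inf X := by
  have hk : 0 ≤ l * colNorm W := mul_nonneg hl (colNorm_nonneg _)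
  calc r1Inf (Matrix.of fun n c => f (CSP P W X n) c)
      ≤ Real.sqrt ((l * colNorm W * r1 X) * (l * (C * colNorm W) * rInf X)) :=
        Real.sqrt_le_sqrt (mul_le_mul (r1_layer_le hP W hl hf1 X) (rInf_layer_le hP W hl hfInf X)
          (rInf_nonneg _) (mul_nonneg hk (r1_nonneg _)))
    _ = Real.sqrt (C * (l * colNorm W) ^ 2 * (r1 X * rInf X)) := by
        congr 1
        ring
    _ = Real.sqrt C * (l * colNorm W) * r1Inf X := by
        rw [Real.sqrt_mul (by positivity), Real.sqrt_mul (Nat.cast_nonneg _), Real.sqrt_sq hk,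
          r1Inf]

end Residuals

/-- Theorem 1: stacking `L` layers of the form `F_ℓ ∘ CSP_{W^{(ℓ)}}`,
where each `F_ℓ` applies `f_ℓ` rowwise and contracts both residual norms by `λ_ℓ`,
yields `r_{1,∞}(Z) ≤ C^{L/2} (λβ)^L r_{1,∞}(X)` with `λ = max_ℓ λ_ℓ`,
`β = max_ℓ ‖W^{(ℓ)}‖₁`. -/
theorem stmt6 {N C L : ℕ}
    (W : Fin L → Matrix (Fin C) (Fin C) ℝ)
    (P : Fin L → Fin C → Matrix (Fin N) (Fin N) ℝ)
    (hP : ∀ ℓ c, IsPermMatrix (P ℓ c))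
    (f : Fin L → (Fin C → ℝ) → (Fin C → ℝ))
    (lamv : Fin L → ℝ)
    (hF1 : ∀ (ℓ : Fin L) (Y : Matrix (Fin N) (Fin C) ℝ) (a : Fin C → ℝ),
      colNorm ((Matrix.of fun n c => f ℓ (Y n) c) - Matrix.of fun _ c => f ℓ a c) ≤
        lamv ℓ * colNorm (Y - Matrix.of fun _ c => a c))
    (hFinf : ∀ (ℓ : Fin L) (Y : Matrix (Fin N) (Fin C) ℝ) (a : Fin C → ℝ),
      rowNorm ((Matrix.of fun n c => f ℓ (Y n) c) - Matrix.of fun _ c => f ℓ a c) ≤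
        lamv ℓ * rowNorm (Y - Matrix.of fun _ c => a c))
    (lam beta : ℝ)
    (hlam : lam = ⨆ ℓ : Fin L, lamv ℓ)
    (hbeta : beta = ⨆ ℓ : Fin L, colNorm (W ℓ))
    (X : Matrix (Fin N) (Fin C) ℝ)
    (Z : Fin (L + 1) → Matrix (Fin N) (Fin C) ℝ)
    (hZ0 : Z 0 = X)
    (hZsucc : ∀ ℓ : Fin L,
      Z ℓ.succ = Matrix.of fun n c => f ℓ ((CSP (P ℓ) (W ℓ) (Z ℓ.castSucc)) n) c) :
    r1Inf (Z (Fin.last L)) ≤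
      Real.sqrt (C : ℝ) ^ L * (lam * beta) ^ L * r1Inf X := by
  rcases isEmpty_or_nonempty (Fin N × Fin C) with hE | ⟨⟨n₀, c₀⟩⟩
  · simp [r1Inf_eq_zero_of_isEmpty]
  have hl : ∀ ℓ, 0 ≤ lamv ℓ := fun ℓ => nonneg_of_colNorm_le_mul n₀.pos c₀.pos (hF1 ℓ)
  have hlam_le : ∀ ℓ, lamv ℓ ≤ lam := fun ℓ =>
    hlam ▸ le_ciSup (Set.finite_range lamv).bddAbove ℓ
  have hbeta_le : ∀ ℓ, colNorm (W ℓ) ≤ beta := fun ℓ =>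
    hbeta ▸ le_ciSup (f := fun ℓ => colNorm (W ℓ)) (Set.finite_range _).bddAbove ℓ
  have hlam0 : 0 ≤ lam := hlam ▸ Real.iSup_nonneg hl
  have hbeta0 : 0 ≤ beta := hbeta ▸ Real.iSup_nonneg fun _ => colNorm_nonneg _
  have hr : ∀ Y : Matrix (Fin N) (Fin C) ℝ, 0 ≤ r1Inf Y := fun _ => Real.sqrt_nonneg _
  have key : ∀ k : Fin (L + 1),
      r1Inf (Z k) ≤ Real.sqrt (C : ℝ) ^ (k : ℕ) * (lam * beta) ^ (k : ℕ) * r1Inf X := by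
    intro k
    induction k using Fin.induction with
    | zero => simp [hZ0]
    | succ ℓ ih =>
      rw [hZsucc ℓ]
      calc _ ≤ Real.sqrt C * (lamv ℓ * colNorm (W ℓ)) * r1Inf (Z ℓ.castSucc) :=
            r1Inf_layer_le (hP ℓ) (W ℓ) (hl ℓ) (hF1 ℓ) (hFinf ℓ) _
        _ ≤ Real.sqrt C * (lam * beta) * r1Inf (Z ℓ.castSucc) :=
            mul_le_mul_of_nonneg_right (mul_le_mul_of_nonneg_left
              (mul_le_mul (hlam_le ℓ) (hbeta_le ℓ) (colNorm_nonneg _) hlam0)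
              (Real.sqrt_nonneg _)) (hr _)
        _ ≤ Real.sqrt C * (lam * beta) * (Real.sqrt (C : ℝ) ^ (ℓ : ℕ) *
              (lam * beta) ^ (ℓ : ℕ) * r1Inf X) :=
            mul_le_mul_of_nonneg_left ih (by positivity)
        _ = _ := by
            rw [Fin.val_succ]
            ring
  exact key (Fin.last L)
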